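/- arXiv:1611.01335 — 6 statements merged into one kernel-verified Lean document; each statement's English description precedes it below -/
import Mathlib

section
/- Let X and Y be independent random variables taking values in finite sets, let Φ be a function in the class 𝓕, and let f = f(X,Y) be any real-valued function whose range lies in the domain of Φ. Then E[Φ(f)] − E_X[Φ(E[f|X])] ≥ E_Y[Φ(E[f|Y])] − Φ(E[f]); equivalently, H_Φ(f|X) ≥ H_Φ(E[f|Y]). -/
open Finset

noncomputable section

/-- A probability mass function on a finite type. -/
def IsPMF {Ω : Type*} [Fintype Ω] (p : Ω → ℝ) : Prop :=
  (∀ ω, 0 ≤ p ω) ∧ ∑ ω, p ω = 1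

/-- Expectation of `f` under the pmf `p`. -/
def expect {Ω : Type*} [Fintype Ω] (p : Ω → ℝ) (f : Ω → ℝ) : ℝ :=
  ∑ ω, p ω * f ω

/-- Variance of `f` under the pmf `p`. -/
def var {Ω : Type*} [Fintype Ω] (p : Ω → ℝ) (f : Ω → ℝ) : ℝ :=
  ∑ ω, p ω * (f ω - expect p f) ^ 2

open scoped Classical in
/-- Conditional expectation `E[f | X]`, as a function on the sample space. -/
def condExp {Ω β : Type*} [Fintype Ω] (p : Ω → ℝ) (f : Ω → ℝ) (X : Ω → β) : Ω → ℝ :=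
  fun ω => (∑ ω', if X ω' = X ω then p ω' * f ω' else 0) /
    (∑ ω', if X ω' = X ω then p ω' else 0)

/-- The Φ-entropy `H_Φ(f) = E[Φ(f)] - Φ(E[f])`. -/
def Hphi {Ω : Type*} [Fintype Ω] (Φ : ℝ → ℝ) (p : Ω → ℝ) (f : Ω → ℝ) : ℝ :=
  expect p (fun ω => Φ (f ω)) - Φ (expect p f)

/-- The conditional Φ-entropy `H_Φ(f | X) = E[Φ(f)] - E[Φ(E[f|X])]`. -/
def HphiCond {Ω β : Type*} [Fintype Ω] (Φ : ℝ → ℝ) (p : Ω → ℝ) (f : Ω → ℝ) (X : Ω → β) : ℝ :=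
  expect p (fun ω => Φ (f ω)) - expect p (fun ω => Φ (condExp p f X ω))

/-- The class 𝓕 of smooth convex non-affine functions `Φ` on a convex domain `D ⊆ ℝ`
such that for every `q ∈ [0,1]` the map
`(s,t) ↦ q Φ(s) + (1-q) Φ(t) - Φ(q s + (1-q) t)` is jointly convex. -/
structure ClassF where
  D : Set ℝ
  Φ : ℝ → ℝ
  convex_dom : Convex ℝ D
  smooth : ContDiffOn ℝ (⊤ : ℕ∞) Φ D
  convexOn : ConvexOn ℝ D Φ
  not_affine : ¬ ∃ a b : ℝ, ∀ t ∈ D, Φ t = a * t + b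
  joint_convex : ∀ q ∈ Set.Icc (0:ℝ) 1,
    ConvexOn ℝ (D ×ˢ D)
      (fun st : ℝ × ℝ => q * Φ st.1 + (1 - q) * Φ st.2 - Φ (q * st.1 + (1 - q) * st.2))

/-- The finite-support Φ-entropy of a function in the class `𝓕` is a convex functional. -/
theorem ClassF.convexOn_entropy (F : ClassF) {β : Type*} (s : Finset β) (b : β → ℝ)
    (hb : ∀ y ∈ s, 0 ≤ b y) (hb1 : ∑ y ∈ s, b y = 1) :
    ConvexOn ℝ (Set.univ.pi fun _ => F.D)
      (fun g : β → ℝ => ∑ y ∈ s, b y * F.Φ (g y) - F.Φ (∑ y ∈ s, b y * g y)) := by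
  classical
  have hconv : Convex ℝ (Set.univ.pi fun _ : β => F.D) :=
    convex_pi fun _ _ => F.convex_dom
  induction s using Finset.induction_on generalizing b with
  | empty => simp at hb1
  | insert y₀ s hy₀ ih =>
    have hq0 : 0 ≤ b y₀ := hb y₀ (mem_insert_self _ _)
    have hbs : ∀ y ∈ s, 0 ≤ b y := fun y hy => hb y (mem_insert_of_mem hy)
    rw [sum_insert hy₀] at hb1
    have hsum : ∑ y ∈ s, b y = 1 - b y₀ := by linarith
    have hs0 : 0 ≤ ∑ y ∈ s, b y := sum_nonneg hbs
    by_cases hq : 1 - b y₀ = 0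
    · have hz : ∀ y ∈ s, b y = 0 := (sum_eq_zero_iff_of_nonneg hbs).1 (hsum.trans hq)
      have hone : b y₀ = 1 := by linarith
      refine (convexOn_const (0 : ℝ) hconv).congr fun g _ => ?_
      have h1 : ∑ y ∈ s, b y * F.Φ (g y) = 0 := sum_eq_zero fun y hy => by simp [hz y hy]
      have h2 : ∑ y ∈ s, b y * g y = 0 := sum_eq_zero fun y hy => by simp [hz y hy]
      simp [sum_insert hy₀, h1, h2, hone]
    · have hq1 : 0 ≤ 1 - b y₀ := hsum ▸ hs0
      have hc : ∀ y ∈ s, 0 ≤ b y / (1 - b y₀) := fun y hy => div_nonneg (hbs y hy) hq1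
      have hc1 : ∑ y ∈ s, b y / (1 - b y₀) = 1 := by
        rw [← sum_div, hsum, div_self hq]
      have hscale : ∀ h : β → ℝ,
          (1 - b y₀) * ∑ y ∈ s, b y / (1 - b y₀) * h y = ∑ y ∈ s, b y * h y := fun h => by
        rw [mul_sum]
        exact sum_congr rfl fun y _ => by field_simp
      let L : (β → ℝ) →ₗ[ℝ] ℝ × ℝ :=
        (LinearMap.proj y₀).prod (∑ y ∈ s, (b y / (1 - b y₀)) • LinearMap.proj y)
      have hL : ∀ g, L g = (g y₀, ∑ y ∈ s, b y / (1 - b y₀) * g y) := fun g => by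
        simp [L]
      have hpair := ((F.joint_convex (b y₀) ⟨hq0, sub_nonneg.1 hq1⟩).comp_linearMap L).subset
        (s := Set.univ.pi fun _ => F.D)
        (fun g hg => by
          have hg' : ∀ y, g y ∈ F.D := fun y => hg y (Set.mem_univ y)
          rw [Set.mem_preimage, hL]
          exact ⟨hg' y₀, F.convex_dom.sum_mem hc hc1 fun y _ => hg' y⟩) hconv
      refine (((ih _ hc hc1).smul hq1).add hpair).congr fun g _ => ?_
      have h1 := hscale fun y => F.Φ (g y)
      have h2 := hscale g
      simp only [Function.comp_apply, Pi.add_apply, hL, smul_eq_mul, sum_insert hy₀, h2]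
      linarith

/-- For a product pmf, composing with `E[f | X]` agrees, up to null points, with integrating out
the second coordinate. -/
theorem mul_condExp_fst {α β : Type*} [Fintype α] [Fintype β] (p : α × β → ℝ) (a : α → ℝ)
    (b : β → ℝ) (hp : ∀ x y, p (x, y) = a x * b y) (hb : ∑ y, b y = 1) (f : α × β → ℝ)
    (Φ : ℝ → ℝ) (x : α) (y : β) :
    a x * b y * Φ (condExp p f Prod.fst (x, y)) = a x * b y * Φ (∑ y', b y' * f (x, y')) := by
  classical
  by_cases ha : a x = 0
  · simp [ha]
  · congr 2
    simp only [condExp, Fintype.sum_prod_type_right, sum_ite_eq', mem_univ, if_true, hp,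
      mul_assoc, ← mul_sum, hb, mul_one]
    field_simp

/-- For a product pmf, composing with `E[f | Y]` agrees, up to null points, with integrating out
the first coordinate. -/
theorem mul_condExp_snd {α β : Type*} [Fintype α] [Fintype β] (p : α × β → ℝ) (a : α → ℝ)
    (b : β → ℝ) (hp : ∀ x y, p (x, y) = a x * b y) (ha : ∑ x, a x = 1) (f : α × β → ℝ)
    (Φ : ℝ → ℝ) (x : α) (y : β) :
    a x * b y * Φ (condExp p f Prod.snd (x, y)) = a x * b y * Φ (∑ x', a x' * f (x', y)) := by
  classical
  by_cases hb : b y = 0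
  · simp [hb]
  · congr 2
    simp only [condExp, Fintype.sum_prod_type, sum_ite_eq', mem_univ, if_true, hp,
      mul_right_comm _ (b y), ← sum_mul, ha, one_mul]
    field_simp

/-- For independent `X`, `Y` (joint pmf `p` on `α × β` factorizing into its
marginals), `Φ ∈ 𝓕`, and any `f = f(X,Y)` with range in the domain of `Φ`:
`H_Φ(f | X) ≥ H_Φ(E[f | Y])`. -/
theorem key_lemma_part_a
    {α β : Type} [Fintype α] [Fintype β]
    (p : α × β → ℝ) (hp : IsPMF p)
    (hind : ∀ x y, p (x, y) = (∑ y', p (x, y')) * (∑ x', p (x', y)))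
    (F : ClassF) (f : α × β → ℝ) (hf : ∀ ω, f ω ∈ F.D) :
    HphiCond F.Φ p f Prod.fst ≥ Hphi F.Φ p (condExp p f Prod.snd) := by
  have hsum : ∑ x, ∑ y, p (x, y) = 1 := by rw [← Fintype.sum_prod_type]; exact hp.2
  have hsum' : ∑ y, ∑ x, p (x, y) = 1 := by rw [sum_comm]; exact hsum
  set a : α → ℝ := fun x => ∑ y, p (x, y)
  set b : β → ℝ := fun y => ∑ x, p (x, y)
  have hpab : ∀ x y, p (x, y) = a x * b y := hind
  have ha0 : ∀ x ∈ univ, 0 ≤ a x := fun x _ => sum_nonneg fun y _ => hp.1 (x, y)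
  have hb0 : ∀ y ∈ univ, 0 ≤ b y := fun y _ => sum_nonneg fun x _ => hp.1 (x, y)
  have ha1 : ∑ x, a x = 1 := hsum
  have hb1 : ∑ y, b y = 1 := hsum'
  clear_value a b
  have hexp : ∀ g : α × β → ℝ, expect p g = ∑ x, ∑ y, a x * b y * g (x, y) := fun g => by
    simp [_root_.expect, Fintype.sum_prod_type, hpab]
  have hfst : expect p (fun ω => F.Φ (condExp p f Prod.fst ω))
      = ∑ x, a x * F.Φ (∑ y, b y * f (x, y)) := by
    rw [hexp]
    refine sum_congr rfl fun x _ => ?_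
    simp only [mul_condExp_fst p a b hpab hb1, ← sum_mul, ← mul_sum, hb1, mul_one]
  have hsnd : ∀ Φ : ℝ → ℝ, expect p (fun ω => Φ (condExp p f Prod.snd ω))
      = ∑ y, b y * Φ (∑ x, a x * f (x, y)) := fun Φ => by
    rw [hexp, sum_comm]
    refine sum_congr rfl fun y _ => ?_
    simp only [mul_condExp_snd p a b hpab ha1, ← sum_mul, ha1, one_mul]
  have hjensen := (F.convexOn_entropy univ b hb0 hb1).map_sum_le ha0 ha1
    (p := fun x y => f (x, y)) fun x _ y _ => hf (x, y)
  simp only [Finset.sum_apply, Pi.smul_apply, smul_eq_mul, mul_sub, sum_sub_distrib] at hjensen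
  have hff : expect p (fun ω => F.Φ (f ω)) = ∑ x, a x * ∑ y, b y * F.Φ (f (x, y)) := by
    simp only [hexp, mul_sum, mul_assoc]
  have hmean := hsnd fun t => t
  simp only [HphiCond, Hphi, hfst, hsnd F.Φ, hff, hmean]
  exact hjensen

end
end

section
/- Let (X, Z, Y) be random variables taking values in finite sets such that X − Z − Y forms a Markov chain (X and Y are conditionally independent given Z), let Φ be a function in the class 𝓕, and let f = f(X,Y,Z) be any real-valued function whose range lies in the domain of Φ. Then H_Φ(f | X,Z) ≥ H_Φ(E[f | Y,Z] | Z). -/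
open Finset

noncomputable section

/-- The Φ-entropy of a finite family of values under fixed weights is a jointly convex function
of the values. -/
theorem ClassF.convexOn_sum_sub (F : ClassF) {ι : Type*} (s : Finset ι) (w : ι → ℝ)
    (hw : ∀ i ∈ s, 0 ≤ w i) (hsum : ∑ i ∈ s, w i = 1) :
    ConvexOn ℝ (Set.univ.pi fun _ : ι => F.D)
      (fun v => ∑ i ∈ s, w i * F.Φ (v i) - F.Φ (∑ i ∈ s, w i * v i)) := by
  classical
  have hconv : Convex ℝ (Set.univ.pi fun _ : ι => F.D) := convex_pi fun _ _ => F.convex_dom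
  induction s using Finset.induction_on generalizing w with
  | empty => simp at hsum
  | insert a s ha ih =>
    rw [Finset.sum_insert ha] at hsum
    have hwa : 0 ≤ w a := hw a (Finset.mem_insert_self a s)
    have hws : ∀ i ∈ s, 0 ≤ w i := fun i hi => hw i (Finset.mem_insert_of_mem hi)
    have hrest : 0 ≤ 1 - w a := by linarith [Finset.sum_nonneg hws]
    rcases hrest.eq_or_lt with h0 | hpos
    · have hzero : ∀ i ∈ s, w i = 0 := (Finset.sum_eq_zero_iff_of_nonneg hws).1 (by linarith)
      have hone : w a = 1 := by linarith
      refine (convexOn_const 0 hconv).congr fun v _ => ?_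
      simp only [Finset.sum_insert ha]
      rw [Finset.sum_eq_zero fun i hi => by rw [hzero i hi, zero_mul],
        Finset.sum_eq_zero fun i hi => by rw [hzero i hi, zero_mul], hone]
      simp
    · set u : ι → ℝ := fun i => w i / (1 - w a) with hu
      have hmul : ∀ i, (1 - w a) * u i = w i := fun i => mul_div_cancel₀ _ hpos.ne'
      have husum : ∑ i ∈ s, u i = 1 := by
        rw [hu, ← Finset.sum_div, div_eq_one_iff_eq hpos.ne']
        linarith
      have hu0 : ∀ i ∈ s, 0 ≤ u i := fun i hi => div_nonneg (hws i hi) hrest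
      let L : (ι → ℝ) →ₗ[ℝ] ℝ × ℝ :=
        (LinearMap.proj a).prod (∑ i ∈ s, u i • LinearMap.proj i)
      have hL : ∀ v, L v = (v a, ∑ i ∈ s, u i * v i) := fun v => by simp [L]
      have hfst := ((F.joint_convex (w a) ⟨hwa, by linarith⟩).comp_linearMap L).subset
        (s := Set.univ.pi fun _ : ι => F.D) (fun v hv => by
          rw [Set.mem_preimage, hL]
          exact ⟨hv a trivial, F.convex_dom.sum_mem hu0 husum fun i _ => hv i trivial⟩) hconv
      refine (hfst.add ((ih u hu0 husum).smul hrest)).congr fun v _ => ?_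
      have hscale : ∀ g : ι → ℝ, (1 - w a) * ∑ i ∈ s, u i * g i = ∑ i ∈ s, w i * g i :=
        fun g => by simp only [Finset.mul_sum, ← mul_assoc, hmul]
      simp only [Pi.add_apply, Function.comp_apply, hL, smul_eq_mul, mul_sub, hscale,
        Finset.sum_insert ha]
      ring

/-- Jensen's inequality for the Φ-entropy under a product of two probability vectors. -/
theorem ClassF.sum_mul_entropy_ge (F : ClassF) {α β : Type*} [Fintype α] [Fintype β]
    (a : α → ℝ) (b : β → ℝ) (ha : ∀ x, 0 ≤ a x) (hb : ∀ y, 0 ≤ b y)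
    (hasum : ∑ x, a x = 1) (hbsum : ∑ y, b y = 1)
    (g : α → β → ℝ) (hg : ∀ x y, g x y ∈ F.D) :
    ∑ y, b y * F.Φ (∑ x, a x * g x y) - F.Φ (∑ x, ∑ y, a x * b y * g x y)
      ≤ ∑ x, a x * (∑ y, b y * F.Φ (g x y) - F.Φ (∑ y, b y * g x y)) := by
  have hjensen := (F.convexOn_sum_sub univ b (fun y _ => hb y) hbsum).map_sum_le
    (t := univ) (w := a) (p := g) (fun x _ => ha x) hasum (fun x _ y _ => hg x y)
  have hswap : ∑ y, b y * ∑ x, a x * g x y = ∑ x, ∑ y, a x * b y * g x y := by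
    simp only [Finset.mul_sum]
    rw [Finset.sum_comm]
    exact Finset.sum_congr rfl fun x _ => Finset.sum_congr rfl fun y _ => by ring
  simpa only [Finset.sum_apply, Pi.smul_apply, smul_eq_mul, hswap] using hjensen

section Coordinates

variable {α β γ : Type*} [Fintype α] [Fintype β] [Fintype γ]

theorem condExp_fst_thd (p f : α × β × γ → ℝ) (x : α) (y : β) (z : γ) :
    condExp p f (fun ω => (ω.1, ω.2.2)) (x, y, z)
      = (∑ y', p (x, y', z) * f (x, y', z)) / ∑ y', p (x, y', z) := by
  classical
  simp [condExp, Fintype.sum_prod_type, ite_and, Finset.sum_ite_irrel]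

theorem condExp_snd (p f : α × β × γ → ℝ) (x : α) (y : β) (z : γ) :
    condExp p f Prod.snd (x, y, z)
      = (∑ x', p (x', y, z) * f (x', y, z)) / ∑ x', p (x', y, z) := by
  classical
  simp [condExp, Fintype.sum_prod_type, ite_and, Finset.sum_ite_irrel]

theorem condExp_thd (p f : α × β × γ → ℝ) (x : α) (y : β) (z : γ) :
    condExp p f (fun ω => ω.2.2) (x, y, z)
      = (∑ x', ∑ y', p (x', y', z) * f (x', y', z)) / ∑ x', ∑ y', p (x', y', z) := by
  classical
  simp [condExp, Fintype.sum_prod_type]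

theorem HphiCond_eq_sum {δ : Type*} (Φ : ℝ → ℝ) (p f : α × β × γ → ℝ) (X : α × β × γ → δ) :
    HphiCond Φ p f X
      = ∑ z, ∑ x, ∑ y, p (x, y, z) * (Φ (f (x, y, z)) - Φ (condExp p f X (x, y, z))) := by
  simp only [HphiCond, _root_.expect, ← Finset.sum_sub_distrib, ← mul_sub, Fintype.sum_prod_type]
  rw [Finset.sum_comm (s := (univ : Finset γ))]
  exact Finset.sum_congr rfl fun x _ => Finset.sum_comm

end Coordinates

/-- Let `(X, Z, Y)` have joint pmf `p` on `α × β × γ` (coordinates `X`, `Y`, `Z`)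
with `X − Z − Y` a Markov chain, `Φ ∈ 𝓕`, and let `f = f(X,Y,Z)` have range in the domain of `Φ`.
Then `H_Φ(f | X,Z) ≥ H_Φ(E[f | Y,Z] | Z)`. -/
theorem key_lemma_part_b
    {α β γ : Type} [Fintype α] [Fintype β] [Fintype γ]
    (p : α × β × γ → ℝ) (hp : IsPMF p)
    (hmarkov : ∀ (x : α) (y : β) (z : γ),
      (∑ x', ∑ y', p (x', y', z)) * p (x, y, z)
        = (∑ y', p (x, y', z)) * (∑ x', p (x', y, z)))
    (F : ClassF) (f : α × β × γ → ℝ) (hf : ∀ ω, f ω ∈ F.D) :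
    HphiCond F.Φ p f (fun ω => (ω.1, ω.2.2))
      ≥ HphiCond F.Φ p (condExp p f Prod.snd) (fun ω => ω.2.2) := by
  rw [ge_iff_le, HphiCond_eq_sum, HphiCond_eq_sum]
  refine Finset.sum_le_sum fun z _ => ?_
  set c := ∑ x, ∑ y, p (x, y, z) with hc
  have hp0 := hp.1
  have hc0 : 0 ≤ c := Finset.sum_nonneg fun x _ => Finset.sum_nonneg fun y _ => hp0 _
  rcases hc0.eq_or_lt with hzero | hpos
  · have hpz : ∀ x y, p (x, y, z) = 0 := fun x y => by
      have hx := (Finset.sum_eq_zero_iff_of_nonneg fun x _ =>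
        Finset.sum_nonneg fun y _ => hp0 (x, y, z)).1 hzero.symm x (mem_univ x)
      exact (Finset.sum_eq_zero_iff_of_nonneg fun y _ => hp0 (x, y, z)).1 hx y (mem_univ y)
    simp [hpz]
  set a : α → ℝ := fun x => (∑ y, p (x, y, z)) / c with ha
  set b : β → ℝ := fun y => (∑ x, p (x, y, z)) / c with hb
  have ha0 : ∀ x, 0 ≤ a x := fun x => div_nonneg (Finset.sum_nonneg fun y _ => hp0 _) hc0
  have hb0 : ∀ y, 0 ≤ b y := fun y => div_nonneg (Finset.sum_nonneg fun x _ => hp0 _) hc0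
  have hasum : ∑ x, a x = 1 := by rw [ha, ← Finset.sum_div, ← hc, div_self hpos.ne']
  have hbsum : ∑ y, b y = 1 := by
    rw [hb, ← Finset.sum_div, Finset.sum_comm, ← hc, div_self hpos.ne']
  have hprod : ∀ x y, p (x, y, z) = c * (a x * b y) := fun x y => by
    have := hmarkov x y z
    simp only [ha, hb]
    field_simp
    linarith
  have hXZ : ∀ x y, a x ≠ 0 → condExp p f (fun ω => (ω.1, ω.2.2)) (x, y, z)
      = ∑ y', b y' * f (x, y', z) := fun x y hx => by
    rw [condExp_fst_thd]
    simp only [hprod, ← Finset.mul_sum, hbsum, mul_assoc]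
    field_simp
  have hYZ : ∀ x y, b y ≠ 0 → condExp p f Prod.snd (x, y, z)
      = ∑ x', a x' * f (x', y, z) := fun x y hy => by
    rw [condExp_snd]
    have hpy : ∀ x', p (x', y, z) = c * b y * a x' := fun x' => by rw [hprod]; ring
    simp only [hpy, mul_assoc, ← Finset.mul_sum, hasum]
    field_simp
  have hZ : ∀ x y, condExp p (condExp p f Prod.snd) (fun ω => ω.2.2) (x, y, z)
      = ∑ x', ∑ y', a x' * b y' * f (x', y', z) := fun x y => by
    have hterm : ∀ x' y', p (x', y', z) * condExp p f Prod.snd (x', y', z)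
        = c * (a x' * (b y' * ∑ x'', a x'' * f (x'', y', z))) := fun x' y' => by
      rcases eq_or_ne (b y') 0 with h | h
      · simp [hprod, h]
      · rw [hYZ _ _ h, hprod]
        ring
    rw [condExp_thd, ← hc]
    simp only [hterm, ← Finset.mul_sum, ← Finset.sum_mul, hasum, one_mul]
    rw [mul_div_cancel_left₀ _ hpos.ne', Finset.sum_comm]
    refine Finset.sum_congr rfl fun y' _ => ?_
    rw [Finset.mul_sum]
    exact Finset.sum_congr rfl fun x' _ => by ring
  have hleft : ∑ x, ∑ y, p (x, y, z) * (F.Φ (condExp p f Prod.snd (x, y, z))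
        - F.Φ (condExp p (condExp p f Prod.snd) (fun ω => ω.2.2) (x, y, z)))
      = c * (∑ y, b y * F.Φ (∑ x, a x * f (x, y, z))
        - F.Φ (∑ x, ∑ y, a x * b y * f (x, y, z))) := by
    have hterm : ∀ x y, p (x, y, z) * (F.Φ (condExp p f Prod.snd (x, y, z))
          - F.Φ (condExp p (condExp p f Prod.snd) (fun ω => ω.2.2) (x, y, z)))
        = c * (a x * (b y * F.Φ (∑ x, a x * f (x, y, z))
          - b y * F.Φ (∑ x, ∑ y, a x * b y * f (x, y, z)))) := fun x y => by
      rw [hZ, hprod]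
      rcases eq_or_ne (b y) 0 with h | h
      · simp [h]
      · rw [hYZ _ _ h]
        ring
    simp only [hterm, ← Finset.mul_sum, ← Finset.sum_mul, hasum, hbsum, one_mul,
      Finset.sum_sub_distrib]
  have hright : ∑ x, ∑ y, p (x, y, z) * (F.Φ (f (x, y, z))
        - F.Φ (condExp p f (fun ω => (ω.1, ω.2.2)) (x, y, z)))
      = c * ∑ x, a x * (∑ y, b y * F.Φ (f (x, y, z)) - F.Φ (∑ y, b y * f (x, y, z))) := by
    have hterm : ∀ x y, p (x, y, z) * (F.Φ (f (x, y, z))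
          - F.Φ (condExp p f (fun ω => (ω.1, ω.2.2)) (x, y, z)))
        = c * (a x * (b y * F.Φ (f (x, y, z)) - b y * F.Φ (∑ y, b y * f (x, y, z)))) :=
      fun x y => by
        rw [hprod]
        rcases eq_or_ne (a x) 0 with h | h
        · simp [h]
        · rw [hXZ _ _ h]
          ring
    simp only [hterm, ← Finset.mul_sum, ← Finset.sum_mul, hbsum, one_mul,
      Finset.sum_sub_distrib]
  rw [hleft, hright]
  exact mul_le_mul_of_nonneg_left (F.sum_mul_entropy_ge a b ha0 hb0 hasum hbsum
    (fun x y => f (x, y, z)) fun x y => hf _) hc0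

end
end

section
/- Let (X, Z, Y) be random variables taking values in finite sets such that X − Z − Y forms a Markov chain (X and Y are conditionally independent given Z), let Φ be a function in the class 𝓕, and let f = f(X,Y,Z) be any real-valued function whose range lies in the domain of Φ. Then H_Φ(E[f|Z]) + H_Φ(f | X,Z) ≥ H_Φ(E[f | Y,Z]). -/
open Finset

noncomputable section

/-- The Jensen gap of `Φ` under a finitely supported probability vector is convex in the
values, as soon as this holds for two-point distributions. -/
lemma convexOn_jensenGap (F : ClassF) {ι : Type*} (s : Finset ι) (w : ι → ℝ)
    (hw : ∀ i ∈ s, 0 ≤ w i) (hw1 : ∑ i ∈ s, w i = 1) :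
    ConvexOn ℝ {g : ι → ℝ | ∀ i, g i ∈ F.D}
      (fun g => ∑ i ∈ s, w i * F.Φ (g i) - F.Φ (∑ i ∈ s, w i * g i)) := by
  classical
  have hdom : Convex ℝ {g : ι → ℝ | ∀ i, g i ∈ F.D} := fun g hg h hh a b ha hb hab i =>
    F.convex_dom (hg i) (hh i) ha hb hab
  induction s using Finset.induction_on generalizing w with
  | empty => simp at hw1
  | insert j s hj ih =>
    have hws : ∀ i ∈ s, 0 ≤ w i := fun i hi => hw i (mem_insert_of_mem hi)
    have hwj : 0 ≤ w j := hw j (mem_insert_self j s)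
    rw [sum_insert hj] at hw1
    have hs0 : 0 ≤ ∑ i ∈ s, w i := sum_nonneg hws
    simp only [sum_insert hj]
    rcases hs0.eq_or_lt with hs | hs
    · have hz : ∀ i ∈ s, w i = 0 := (sum_eq_zero_iff_of_nonneg hws).1 hs.symm
      have hj1 : w j = 1 := by linarith
      have hsum : ∀ h : ι → ℝ, ∑ i ∈ s, w i * h i = 0 := fun h =>
        sum_eq_zero fun i hi => by rw [hz i hi, zero_mul]
      simp only [hsum, hj1, one_mul, add_zero, sub_self]
      exact convexOn_const 0 hdom
    · have hne : ∑ i ∈ s, w i ≠ 0 := hs.ne'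
      set r := ∑ i ∈ s, w i with hr
      have hv0 : ∀ i ∈ s, 0 ≤ w i / r := fun i hi => div_nonneg (hws i hi) hs.le
      have hv1 : ∑ i ∈ s, w i / r = 1 := by rw [← sum_div, ← hr, div_self hne]
      have hrest := (ih (fun i => w i / r) hv0 hv1).smul hs.le
      have hscale : ∀ h : ι → ℝ, r * ∑ i ∈ s, w i / r * h i = ∑ i ∈ s, w i * h i := fun h => by
        rw [mul_sum]
        exact sum_congr rfl fun i _ => by field_simp
      let L : (ι → ℝ) →ₗ[ℝ] ℝ × ℝ :=
        (LinearMap.proj j).prod (∑ i ∈ s, (w i / r) • LinearMap.proj i)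
      have hL : ∀ g, L g = (g j, ∑ i ∈ s, w i / r * g i) := fun g => by
        simp [L]
      have htwo := ((F.joint_convex (w j) ⟨hwj, by linarith⟩).comp_linearMap L).subset
        (s := {g : ι → ℝ | ∀ i, g i ∈ F.D}) (fun g hg => by
          rw [Set.mem_preimage, hL]
          exact ⟨hg j, F.convex_dom.sum_mem hv0 hv1 fun i _ => hg i⟩) hdom
      refine (hrest.add htwo).congr fun g _ => ?_
      have hr' : 1 - w j = r := by linarith
      simp only [Pi.add_apply, Function.comp_apply, hL, smul_eq_mul, hr', hscale, mul_sub]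
      ring

/-- Tensorization of the Φ-entropy gap over a product of two probability vectors. -/
lemma product_gap_nonneg (F : ClassF) {α β : Type*} [Fintype α] [Fintype β]
    (a : α → ℝ) (b : β → ℝ) (ha : IsPMF a) (hb : IsPMF b)
    (f : α → β → ℝ) (hf : ∀ x y, f x y ∈ F.D) :
    0 ≤ ∑ x, ∑ y, a x * b y * (F.Φ (f x y) - F.Φ (∑ y', b y' * f x y')
      - F.Φ (∑ x', a x' * f x' y) + F.Φ (∑ x', ∑ y', a x' * b y' * f x' y')) := by
  have h := (convexOn_jensenGap F univ b (fun i _ => hb.1 i) hb.2).map_sum_le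
    (t := univ) (w := a) (p := f) (fun i _ => ha.1 i) ha.2 (fun x _ => hf x)
  simp only [Finset.sum_apply, Pi.smul_apply, smul_eq_mul] at h
  have hmean : ∑ y, b y * ∑ x, a x * f x y = ∑ x', ∑ y', a x' * b y' * f x' y' := by
    simp only [mul_sum]
    rw [sum_comm]
    exact sum_congr rfl fun _ _ => sum_congr rfl fun _ _ => by ring
  rw [hmean] at h
  set M := ∑ x', ∑ y', a x' * b y' * f x' y'
  have h1 : ∑ x, ∑ y, a x * b y * F.Φ (∑ y', b y' * f x y')
      = ∑ x, a x * F.Φ (∑ y', b y' * f x y') :=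
    sum_congr rfl fun x _ => by rw [← sum_mul, ← mul_sum, hb.2, mul_one]
  have h2 : ∑ x, ∑ y, a x * b y * F.Φ (∑ x', a x' * f x' y)
      = ∑ y, b y * F.Φ (∑ x', a x' * f x' y) := by
    rw [sum_comm]
    exact sum_congr rfl fun y _ => by rw [← sum_mul, ← sum_mul, ha.2, one_mul]
  have h3 : ∑ x, ∑ y, a x * b y * F.Φ M = F.Φ M := by
    simp only [← sum_mul, ← mul_sum, hb.2, ha.2, mul_one, one_mul]
  have h4 : ∑ x, a x * ∑ y, b y * F.Φ (f x y) = ∑ x, ∑ y, a x * b y * F.Φ (f x y) := by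
    simp only [mul_sum, mul_assoc]
  simp only [mul_sub, sum_sub_distrib, h4] at h
  simp only [mul_add, mul_sub, sum_add_distrib, sum_sub_distrib, h1, h2, h3]
  linarith

/-- The gap inequality for an unnormalized weight on a product satisfying the independence
relation. -/
lemma weighted_gap_nonneg (F : ClassF) {α β : Type*} [Fintype α] [Fintype β]
    (q : α → β → ℝ) (hq : ∀ x y, 0 ≤ q x y)
    (hind : ∀ x y, (∑ x', ∑ y', q x' y') * q x y = (∑ y', q x y') * ∑ x', q x' y)
    (f : α → β → ℝ) (hf : ∀ x y, f x y ∈ F.D) :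
    0 ≤ ∑ x, ∑ y, q x y * (F.Φ (f x y)
      - F.Φ ((∑ y', q x y' * f x y') / ∑ y', q x y')
      - F.Φ ((∑ x', q x' y * f x' y) / ∑ x', q x' y)
      + F.Φ ((∑ x', ∑ y', q x' y' * f x' y') / ∑ x', ∑ y', q x' y')) := by
  have hQ0 : 0 ≤ ∑ x', ∑ y', q x' y' := sum_nonneg fun x _ => sum_nonneg fun y _ => hq x y
  rcases hQ0.eq_or_lt with h0 | hpos
  · have hz : ∀ x y, q x y = 0 := fun x y =>
      (sum_eq_zero_iff_of_nonneg fun y _ => hq x y).1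
        ((sum_eq_zero_iff_of_nonneg fun x _ => sum_nonneg fun y _ => hq x y).1 h0.symm x
          (mem_univ x)) y (mem_univ y)
    simp [hz]
  set Q := ∑ x', ∑ y', q x' y' with hQ
  have hne : Q ≠ 0 := hpos.ne'
  set a : α → ℝ := fun x => (∑ y', q x y') / Q with ha
  set b : β → ℝ := fun y => (∑ x', q x' y) / Q with hb
  have hfac : ∀ x y, q x y = Q * (a x * b y) := fun x y => by
    have := hind x y
    simp only [ha, hb]
    field_simp
    linarith
  have ha1 : IsPMF a := ⟨fun x => div_nonneg (sum_nonneg fun y _ => hq x y) hpos.le, by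
    simp only [ha]; rw [← sum_div, ← hQ, div_self hne]⟩
  have hb1 : IsPMF b := ⟨fun y => div_nonneg (sum_nonneg fun x _ => hq x y) hpos.le, by
    simp only [hb]; rw [← sum_div, sum_comm, ← hQ, div_self hne]⟩
  have hrow : ∀ x, ∑ y', q x y' = Q * a x := fun x => by simp only [ha]; field_simp
  have hcol : ∀ y, ∑ x', q x' y = Q * b y := fun y => by simp only [hb]; field_simp
  have key := mul_nonneg hpos.le (product_gap_nonneg F a b ha1 hb1 f hf)
  refine key.trans_eq ?_
  rw [mul_sum]
  refine sum_congr rfl fun x _ => ?_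
  rw [mul_sum]
  refine sum_congr rfl fun y _ => ?_
  rw [← mul_assoc, ← hfac]
  by_cases hxy : q x y = 0
  · simp [hxy]
  have hax : a x ≠ 0 := fun h => hxy (by rw [hfac, h]; ring)
  have hby : b y ≠ 0 := fun h => hxy (by rw [hfac, h]; ring)
  have e1 : (∑ y', q x y' * f x y') / ∑ y', q x y' = ∑ y', b y' * f x y' := by
    rw [hrow, div_eq_iff (mul_ne_zero hne hax), sum_mul]
    exact sum_congr rfl fun y' _ => by rw [hfac]; ring
  have e2 : (∑ x', q x' y * f x' y) / ∑ x', q x' y = ∑ x', a x' * f x' y := by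
    rw [hcol, div_eq_iff (mul_ne_zero hne hby), sum_mul]
    exact sum_congr rfl fun x' _ => by rw [hfac]; ring
  have e3 : (∑ x', ∑ y', q x' y' * f x' y') / Q = ∑ x', ∑ y', a x' * b y' * f x' y' := by
    rw [div_eq_iff hne, sum_mul]
    refine sum_congr rfl fun x' _ => ?_
    rw [sum_mul]
    exact sum_congr rfl fun y' _ => by rw [hfac]; ring
  rw [e1, e2, e3]

lemma condExp_apply {Ω β : Type*} [Fintype Ω] [DecidableEq β] (p f : Ω → ℝ) (X : Ω → β)
    (ω : Ω) : condExp p f X ω = (∑ ω', if X ω' = X ω then p ω' * f ω' else 0) /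
      (∑ ω', if X ω' = X ω then p ω' else 0) := by
  unfold condExp
  congr!

/-- Averaging a conditional expectation recovers the expectation. -/
lemma expect_condExp {Ω β : Type*} [Fintype Ω] (p : Ω → ℝ) (hp : ∀ ω, 0 ≤ p ω)
    (f : Ω → ℝ) (X : Ω → β) : expect p (condExp p f X) = expect p f := by
  classical
  have hcancel : ∀ ω', (∑ ω, if X ω' = X ω then p ω / (∑ ω'', if X ω'' = X ω then p ω'' else 0)
      else 0) * p ω' = p ω' := fun ω' => by
    by_cases h0 : p ω' = 0
    · simp [h0]
    have hpos : 0 < ∑ ω'', if X ω'' = X ω' then p ω'' else 0 :=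
      sum_pos' (fun i _ => by split_ifs <;> simp [hp])
        ⟨ω', mem_univ _, by simpa using lt_of_le_of_ne (hp ω') (Ne.symm h0)⟩
    have : (∑ ω, if X ω' = X ω then p ω / (∑ ω'', if X ω'' = X ω then p ω'' else 0) else 0)
        = (∑ ω, if X ω = X ω' then p ω else 0) / ∑ ω'', if X ω'' = X ω' then p ω'' else 0 := by
      rw [sum_div]
      refine sum_congr rfl fun ω _ => ?_
      by_cases h : X ω = X ω'
      · simp [h]
      · simp [h, Ne.symm h]
    rw [this, div_self hpos.ne', one_mul]
  calc expect p (condExp p f X)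
      = ∑ ω, ∑ ω', (if X ω' = X ω then p ω / (∑ ω'', if X ω'' = X ω then p ω'' else 0) else 0)
          * p ω' * f ω' := by
        refine sum_congr rfl fun ω _ => ?_
        rw [condExp, mul_div_assoc', mul_sum, sum_div]
        refine sum_congr rfl fun ω' _ => ?_
        split_ifs
        · ring
        · simp
    _ = expect p f := by
        rw [sum_comm]
        refine sum_congr rfl fun ω' _ => ?_
        rw [← sum_mul, ← sum_mul, hcancel]

/-- Let `(X, Z, Y)` have joint pmf `p` on `α × β × γ` (coordinates `X`, `Y`, `Z`)
with `X − Z − Y` a Markov chain, `Φ ∈ 𝓕`, and let `f = f(X,Y,Z)` have range in the domain of `Φ`.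
Then `H_Φ(E[f|Z]) + H_Φ(f | X,Z) ≥ H_Φ(E[f | Y,Z])`. -/
theorem key_lemma_part_c
    {α β γ : Type} [Fintype α] [Fintype β] [Fintype γ]
    (p : α × β × γ → ℝ) (hp : IsPMF p)
    (hmarkov : ∀ (x : α) (y : β) (z : γ),
      (∑ x', ∑ y', p (x', y', z)) * p (x, y, z)
        = (∑ y', p (x, y', z)) * (∑ x', p (x', y, z)))
    (F : ClassF) (f : α × β × γ → ℝ) (hf : ∀ ω, f ω ∈ F.D) :
    Hphi F.Φ p (condExp p f (fun ω => ω.2.2)) + HphiCond F.Φ p f (fun ω => (ω.1, ω.2.2))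
      ≥ Hphi F.Φ p (condExp p f Prod.snd) := by
  classical
  have hZ : ∀ x y z, condExp p f (fun ω => ω.2.2) (x, y, z)
      = (∑ x', ∑ y', p (x', y', z) * f (x', y', z)) / ∑ x', ∑ y', p (x', y', z) := fun x y z => by
    simp [condExp_apply, Fintype.sum_prod_type]
  have hXZ : ∀ x y z, condExp p f (fun ω => (ω.1, ω.2.2)) (x, y, z)
      = (∑ y', p (x, y', z) * f (x, y', z)) / ∑ y', p (x, y', z) := fun x y z => by
    simp [condExp_apply, Fintype.sum_prod_type, ite_and]
  have hYZ : ∀ x y z, condExp p f Prod.snd (x, y, z)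
      = (∑ x', p (x', y, z) * f (x', y, z)) / ∑ x', p (x', y, z) := fun x y z => by
    simp [condExp_apply, Fintype.sum_prod_type]
  have hgap : 0 ≤ expect p (fun ω => F.Φ (f ω) - F.Φ (condExp p f (fun ω => (ω.1, ω.2.2)) ω)
      - F.Φ (condExp p f Prod.snd ω) + F.Φ (condExp p f (fun ω => ω.2.2) ω)) := by
    have h := sum_nonneg fun z (_ : z ∈ (univ : Finset γ)) =>
      weighted_gap_nonneg F (fun x y => p (x, y, z)) (fun x y => hp.1 _)
        (fun x y => hmarkov x y z) (fun x y => f (x, y, z)) (fun x y => hf _)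
    refine h.trans_eq ?_
    simp only [_root_.expect, Fintype.sum_prod_type, hZ, hXZ, hYZ]
    rw [sum_comm]
    exact sum_congr rfl fun x _ => sum_comm
  simp only [Hphi, HphiCond, expect_condExp p hp.1]
  simp only [_root_.expect, mul_add, mul_sub, sum_add_distrib, sum_sub_distrib] at hgap ⊢
  linarith

end
end

section
/- Subadditivity of Φ-entropy: let X_1, …, X_k be mutually independent random variables taking values in finite sets, let Φ be a function in the class 𝓕, and let f be any real-valued function of (X_1, …, X_k) whose range lies in the domain of Φ. Then H_Φ(f) ≤ Σ_{i=1}^k H_Φ(f | X_{î}), where X_{î} = (X_1, …, X_{i−1}, X_{i+1}, …, X_k). -/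
open Finset

noncomputable section

/-- The Φ-entropy with unnormalized weights is convex in the function, as it is built up from
two-point Φ-entropies. -/
theorem ClassF.convexOn_weighted_entropy {A : Type*} (F : ClassF) (w : A → ℝ)
    (hw : ∀ a, 0 ≤ w a) (s : Finset A) :
    ConvexOn ℝ {g : A → ℝ | ∀ a, g a ∈ F.D} (fun g => ∑ a ∈ s, w a * F.Φ (g a) -
      (∑ a ∈ s, w a) * F.Φ ((∑ a ∈ s, w a * g a) / ∑ a ∈ s, w a)) := by
  classical
  have hconv : Convex ℝ {g : A → ℝ | ∀ a, g a ∈ F.D} := fun x hx y hy u v hu hv huv a =>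
    F.convex_dom (hx a) (hy a) hu hv huv
  induction s using Finset.induction_on with
  | empty => simpa using convexOn_const (0 : ℝ) hconv
  | insert a s ha ih =>
    have hW : 0 ≤ ∑ b ∈ s, w b := Finset.sum_nonneg fun b _ => hw b
    rcases hW.eq_or_lt with h0 | hpos
    · have hz : ∀ b ∈ s, w b = 0 := (Finset.sum_eq_zero_iff_of_nonneg fun b _ => hw b).1 h0.symm
      have hzero : ∀ h : A → ℝ, ∑ b ∈ s, w b * h b = 0 := fun h =>
        Finset.sum_eq_zero fun b hb => by rw [hz b hb, zero_mul]
      refine (convexOn_const (0 : ℝ) hconv).congr fun g _ => ?_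
      have hΦ := hzero fun b => F.Φ (g b)
      simp only [Finset.sum_insert ha, hzero g, hΦ, ← h0, add_zero]
      rcases eq_or_ne (w a) 0 with hwa | hwa
      · simp [hwa]
      · rw [mul_div_cancel_left₀ _ hwa, sub_self]
    · set W := ∑ b ∈ s, w b with hWdef
      have hV : 0 < w a + W := add_pos_of_nonneg_of_pos (hw a) hpos
      have hq : W / (w a + W) ∈ Set.Icc (0 : ℝ) 1 :=
        ⟨by positivity, (div_le_one hV).2 (by linarith [hw a])⟩
      let L : (A → ℝ) →ₗ[ℝ] ℝ × ℝ :=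
        { toFun := fun g => ((∑ b ∈ s, w b * g b) / W, g a)
          map_add' := fun g h => by
            simp [mul_add, Finset.sum_add_distrib, add_div]
          map_smul' := fun c g => by
            simp [mul_left_comm _ c, ← Finset.mul_sum, mul_div_assoc] }
      have hmem : ∀ g : A → ℝ, (∀ a, g a ∈ F.D) → L g ∈ F.D ×ˢ F.D := fun g hg => by
        refine ⟨?_, hg a⟩
        have := F.convex_dom.sum_mem (t := s) (w := fun b => w b / W) (z := g)
          (fun b _ => div_nonneg (hw b) hW) (by rw [← Finset.sum_div]; exact div_self hpos.ne')
          (fun b _ => hg b)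
        simpa [L, Finset.sum_div, div_mul_eq_mul_div] using this
      have h2 := (((F.joint_convex _ hq).comp_linearMap L).subset
        (fun g hg => hmem g hg) hconv).smul hV.le
      refine (ih.add h2).congr fun g _ => ?_
      have harg : W / (w a + W) * ((∑ b ∈ s, w b * g b) / W) + (1 - W / (w a + W)) * g a
          = (w a * g a + ∑ b ∈ s, w b * g b) / (w a + W) := by
        field_simp
        ring
      simp only [Pi.add_apply, Function.comp_apply, L, LinearMap.coe_mk, AddHom.coe_mk,
        smul_eq_mul, Finset.sum_insert ha, harg]
      field_simp
      ring

theorem expect_mono {Ω : Type*} [Fintype Ω] {p : Ω → ℝ} (hp : ∀ ω, 0 ≤ p ω) {f g : Ω → ℝ}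
    (h : ∀ ω, f ω ≤ g ω) : expect p f ≤ expect p g :=
  Finset.sum_le_sum fun ω _ => mul_le_mul_of_nonneg_left (h ω) (hp ω)

theorem expect_sub {Ω : Type*} [Fintype Ω] (p f g : Ω → ℝ) :
    expect p (fun ω => f ω - g ω) = expect p f - expect p g := by
  simp only [_root_.expect, mul_sub, Finset.sum_sub_distrib]

/-- The average of `g` over the coordinate `i`, weighted by `μ i`. -/
def coordAvg {ι : Type*} [DecidableEq ι] {α : ι → Type*} [∀ i, Fintype (α i)]
    (μ : ∀ i, α i → ℝ) (i : ι) (g : (∀ i, α i) → ℝ) : (∀ i, α i) → ℝ :=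
  fun ω => ∑ a, μ i a * g (Function.update ω i a)

theorem prod_update_eq_mul_erase {ι : Type*} [DecidableEq ι] [Fintype ι] {α : ι → Type*}
    {μ : ∀ i, α i → ℝ} (i : ι) (ω : ∀ i, α i) (a : α i) :
    ∏ j, μ j (Function.update ω i a j) = μ i a * ∏ j ∈ univ.erase i, μ j (ω j) := by
  rw [← Finset.mul_prod_erase univ _ (mem_univ i), Function.update_self]
  congr 1
  exact Finset.prod_congr rfl fun j hj => by
    rw [Function.update_of_ne (Finset.ne_of_mem_erase hj)]

section Product

variable {ι : Type*} [DecidableEq ι] {α : ι → Type*} [∀ i, Fintype (α i)] {μ : ∀ i, α i → ℝ}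

theorem coordAvg_mem (hμ : ∀ i, IsPMF (μ i)) {D : Set ℝ} (hD : Convex ℝ D) (i : ι)
    {g : (∀ i, α i) → ℝ} (hg : ∀ ω, g ω ∈ D) (ω : ∀ i, α i) : coordAvg μ i g ω ∈ D := by
  simpa only [smul_eq_mul, coordAvg] using hD.sum_mem (t := univ) (fun a _ => (hμ i).1 a)
    (hμ i).2 (fun a _ => hg (Function.update ω i a))

theorem coordAvg_list_mem (hμ : ∀ i, IsPMF (μ i)) {D : Set ℝ} (hD : Convex ℝ D) (l : List ι)
    {g : (∀ i, α i) → ℝ} (hg : ∀ ω, g ω ∈ D) (ω : ∀ i, α i) :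
    l.foldr (coordAvg μ) g ω ∈ D := by
  induction l generalizing ω with
  | nil => exact hg ω
  | cons i l ih => exact coordAvg_mem hμ hD i ih ω

theorem coordAvg_list_update (l : List ι) (g : (∀ i, α i) → ℝ) {j : ι} (hj : j ∈ l)
    (ω : ∀ i, α i) (b : α j) :
    l.foldr (coordAvg μ) g (Function.update ω j b) = l.foldr (coordAvg μ) g ω := by
  induction l generalizing ω with
  | nil => simp at hj
  | cons i l ih =>
    refine Finset.sum_congr rfl fun a _ => ?_
    rcases eq_or_ne j i with rfl | hji
    · rw [Function.update_idem]
    · rw [Function.update_comm hji, ih (List.mem_of_ne_of_mem hji hj)]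

variable [Fintype ι]

theorem expect_coordAvg (hμ : ∀ i, IsPMF (μ i)) (i : ι) (g : (∀ i, α i) → ℝ) :
    expect (fun ω => ∏ j, μ j (ω j)) (coordAvg μ i g) = expect (fun ω => ∏ j, μ j (ω j)) g := by
  let e : (∀ i, α i) × α i ≃ (∀ i, α i) × α i :=
    { toFun := fun x => (Function.update x.1 i x.2, x.1 i)
      invFun := fun x => (Function.update x.1 i x.2, x.1 i)
      left_inv := fun x => by simp
      right_inv := fun x => by simp }
  have hprod : ∀ ω : ∀ i, α i,
      ∏ j, μ j (ω j) = μ i (ω i) * ∏ j ∈ univ.erase i, μ j (ω j) := fun ω =>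
    (Finset.mul_prod_erase univ _ (mem_univ i)).symm
  calc ∑ ω, (∏ j, μ j (ω j)) * ∑ a, μ i a * g (Function.update ω i a)
      = ∑ x : (∀ i, α i) × α i, (∏ j, μ j (x.1 j)) * (μ i x.2 * g (Function.update x.1 i x.2)) := by
        rw [Fintype.sum_prod_type]
        simp only [Finset.mul_sum]
    _ = ∑ x : (∀ i, α i) × α i, (∏ j, μ j (x.1 j)) * (μ i x.2 * g x.1) := by
        refine Fintype.sum_equiv e _ _ fun x => ?_
        simp only [e, Equiv.coe_fn_mk, prod_update_eq_mul_erase, hprod x.1]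
        ring
    _ = ∑ ω, (∏ j, μ j (ω j)) * g ω := by
        rw [Fintype.sum_prod_type]
        refine Finset.sum_congr rfl fun ω _ => ?_
        dsimp only
        rw [← Finset.mul_sum, ← Finset.sum_mul, (hμ i).2, one_mul]

theorem expect_coordAvg_list (hμ : ∀ i, IsPMF (μ i)) (l : List ι) (g : (∀ i, α i) → ℝ) :
    expect (fun ω => ∏ j, μ j (ω j)) (l.foldr (coordAvg μ) g) =
      expect (fun ω => ∏ j, μ j (ω j)) g := by
  induction l with
  | nil => rfl
  | cons i l ih => rw [List.foldr_cons, expect_coordAvg hμ, ih]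

theorem isPMF_prod (hμ : ∀ i, IsPMF (μ i)) : IsPMF fun ω : ∀ i, α i => ∏ j, μ j (ω j) := by
  refine ⟨fun ω => Finset.prod_nonneg fun j _ => (hμ j).1 _, ?_⟩
  rw [← Fintype.prod_sum]
  exact Finset.prod_eq_one fun j _ => (hμ j).2

theorem coordAvg_list_univ (hμ : ∀ i, IsPMF (μ i)) (l : List ι) (hl : ∀ i, i ∈ l)
    (g : (∀ i, α i) → ℝ) (ω : ∀ i, α i) :
    l.foldr (coordAvg μ) g ω = expect (fun ω => ∏ j, μ j (ω j)) g := by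
  have hconst : ∀ ω', l.foldr (coordAvg μ) g ω' = l.foldr (coordAvg μ) g ω := fun ω' => by
    have key : ∀ s : Finset ι,
        l.foldr (coordAvg μ) g (s.piecewise ω' ω) = l.foldr (coordAvg μ) g ω := fun s => by
      induction s using Finset.induction_on with
      | empty => simp
      | insert j s _ ih => rw [Finset.piecewise_insert, coordAvg_list_update l g (hl j), ih]
    simpa using key univ
  rw [← expect_coordAvg_list hμ l]
  simp only [_root_.expect, hconst]
  rw [← Finset.sum_mul, (isPMF_prod hμ).2, one_mul]

/-- The expected Φ-entropy in coordinate `i` does not increase when another coordinate is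
averaged out. -/
theorem entropy_coordAvg_le (hμ : ∀ i, IsPMF (μ i)) (F : ClassF) {i j : ι} (hij : i ≠ j)
    {g : (∀ i, α i) → ℝ} (hg : ∀ ω, g ω ∈ F.D) :
    expect (fun ω => ∏ j, μ j (ω j)) (fun ω => F.Φ (coordAvg μ j g ω)) -
        expect (fun ω => ∏ j, μ j (ω j)) (fun ω => F.Φ (coordAvg μ i (coordAvg μ j g) ω)) ≤
      expect (fun ω => ∏ j, μ j (ω j)) (fun ω => F.Φ (g ω)) -
        expect (fun ω => ∏ j, μ j (ω j)) (fun ω => F.Φ (coordAvg μ i g ω)) := by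
  have hpos := (isPMF_prod hμ).1
  let ent : ((∀ i, α i) → ℝ) → (∀ i, α i) → ℝ := fun h ω =>
    coordAvg μ i (fun ω => F.Φ (h ω)) ω - F.Φ (coordAvg μ i h ω)
  have hent : ∀ h : (∀ i, α i) → ℝ, expect (fun ω => ∏ j, μ j (ω j)) (fun ω => F.Φ (h ω)) -
      expect (fun ω => ∏ j, μ j (ω j)) (fun ω => F.Φ (coordAvg μ i h ω)) =
      expect (fun ω => ∏ j, μ j (ω j)) (ent h) := fun h => by
    rw [← expect_coordAvg hμ i (fun ω => F.Φ (h ω))]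
    exact (expect_sub _ _ _).symm
  rw [hent, hent, ← expect_coordAvg hμ j (ent g)]
  refine expect_mono hpos fun ω => ?_
  have hJ := (F.convexOn_weighted_entropy (μ i) (hμ i).1 univ).map_sum_le (t := univ)
    (w := μ j) (p := fun b a => g (Function.update (Function.update ω j b) i a))
    (fun b _ => (hμ j).1 b) (hμ j).2 (fun b _ a => hg _)
  simp only [(hμ i).2, one_mul, div_one, smul_eq_mul, Finset.sum_apply, Pi.smul_apply] at hJ
  have hcomm : ∀ b a, Function.update (Function.update ω j b) i a =
      Function.update (Function.update ω i a) j b := fun b a =>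
    Function.update_comm hij.symm _ _ _
  simp only [hcomm] at hJ
  simpa only [ent, coordAvg, hcomm] using hJ

theorem entropy_coordAvg_list_le (hμ : ∀ i, IsPMF (μ i)) (F : ClassF) {i : ι} (l : List ι)
    (hi : i ∉ l) {g : (∀ i, α i) → ℝ} (hg : ∀ ω, g ω ∈ F.D) :
    expect (fun ω => ∏ j, μ j (ω j)) (fun ω => F.Φ (l.foldr (coordAvg μ) g ω)) -
        expect (fun ω => ∏ j, μ j (ω j))
          (fun ω => F.Φ (coordAvg μ i (l.foldr (coordAvg μ) g) ω)) ≤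
      expect (fun ω => ∏ j, μ j (ω j)) (fun ω => F.Φ (g ω)) -
        expect (fun ω => ∏ j, μ j (ω j)) (fun ω => F.Φ (coordAvg μ i g ω)) := by
  induction l with
  | nil => exact le_rfl
  | cons j l ih =>
    rw [List.mem_cons, not_or] at hi
    exact (entropy_coordAvg_le hμ F hi.1 (coordAvg_list_mem hμ F.convex_dom l hg)).trans (ih hi.2)

theorem entropy_sub_coordAvg_list_le_sum (hμ : ∀ i, IsPMF (μ i)) (F : ClassF) (l : List ι)
    (hl : l.Nodup) {g : (∀ i, α i) → ℝ} (hg : ∀ ω, g ω ∈ F.D) :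
    expect (fun ω => ∏ j, μ j (ω j)) (fun ω => F.Φ (g ω)) -
        expect (fun ω => ∏ j, μ j (ω j)) (fun ω => F.Φ (l.foldr (coordAvg μ) g ω)) ≤
      (l.map fun i => expect (fun ω => ∏ j, μ j (ω j)) (fun ω => F.Φ (g ω)) -
        expect (fun ω => ∏ j, μ j (ω j)) (fun ω => F.Φ (coordAvg μ i g ω))).sum := by
  induction l with
  | nil => simp
  | cons i l ih =>
    rw [List.nodup_cons] at hl
    rw [List.map_cons, List.sum_cons, List.foldr_cons]
    linarith [ih hl.2, entropy_coordAvg_list_le hμ F l hl.1 hg]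

/-- Subadditivity of Φ-entropy for a product weight, in terms of coordinate averages. -/
theorem Hphi_prod_le_sum_coordAvg (hμ : ∀ i, IsPMF (μ i)) (F : ClassF)
    {g : (∀ i, α i) → ℝ} (hg : ∀ ω, g ω ∈ F.D) :
    Hphi F.Φ (fun ω : ∀ i, α i => ∏ j, μ j (ω j)) g ≤
      ∑ i, (expect (fun ω : ∀ i, α i => ∏ j, μ j (ω j)) (fun ω => F.Φ (g ω)) -
        expect (fun ω : ∀ i, α i => ∏ j, μ j (ω j)) (fun ω => F.Φ (coordAvg μ i g ω))) := by
  have h := entropy_sub_coordAvg_list_le_sum hμ F univ.toList (Finset.nodup_toList _) hg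
  simp only [coordAvg_list_univ hμ univ.toList (fun i => by simp) g] at h
  rw [Finset.sum_map_toList] at h
  refine le_trans (le_of_eq ?_) h
  rw [Hphi]
  congr 1
  simp only [_root_.expect]
  rw [← Finset.sum_mul, (isPMF_prod hμ).2, one_mul]

theorem sum_ite_restrict_eq (i : ι) (ω : ∀ i, α i) (h : (∀ i, α i) → ℝ)
    [DecidablePred fun ω' : ∀ i, α i =>
      (fun j : {j : ι // j ≠ i} => ω' j.1) = fun j : {j : ι // j ≠ i} => ω j.1] :
    (∑ ω' : ∀ i, α i,
      if (fun j : {j : ι // j ≠ i} => ω' j.1) = (fun j : {j : ι // j ≠ i} => ω j.1)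
      then h ω' else 0) = ∑ a, h (Function.update ω i a) := by
  rw [← Finset.sum_filter]
  have hupd : ∀ ω' : ∀ i, α i,
      (fun j : {j : ι // j ≠ i} => ω' j.1) = (fun j : {j : ι // j ≠ i} => ω j.1) →
      Function.update ω i (ω' i) = ω' := fun ω' hω' => by
    funext j
    rcases eq_or_ne j i with rfl | hj
    · simp
    · rw [Function.update_of_ne hj]
      exact (congrFun hω' (⟨j, hj⟩ : {j : ι // j ≠ i})).symm
  refine Finset.sum_bij' (fun ω' _ => ω' i) (fun a _ => Function.update ω i a)
    (fun _ _ => mem_univ _) (fun a _ => ?_) (fun ω' hω' => ?_) (fun a _ => ?_)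
    (fun ω' hω' => ?_)
  · rw [Finset.mem_filter]
    exact ⟨mem_univ _, funext fun j => Function.update_of_ne j.2 _ _⟩
  · exact hupd ω' (Finset.mem_filter.1 hω').2
  · simp
  · rw [hupd ω' (Finset.mem_filter.1 hω').2]

/-- Under a product weight, conditioning on all coordinates but `i` averages out coordinate `i`. -/
theorem condExp_prod_eq_coordAvg (hμ : ∀ i, IsPMF (μ i)) (i : ι) (g : (∀ i, α i) → ℝ)
    {ω : ∀ i, α i} (hω : ∏ j, μ j (ω j) ≠ 0) :
    condExp (fun ω => ∏ j, μ j (ω j)) g (fun ω => fun j : {j : ι // j ≠ i} => ω j.1) ω =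
      coordAvg μ i g ω := by
  have hR : ∏ j ∈ univ.erase i, μ j (ω j) ≠ 0 := fun h => hω <| by
    rw [← Finset.mul_prod_erase univ _ (mem_univ i), h, mul_zero]
  rw [condExp, sum_ite_restrict_eq, sum_ite_restrict_eq]
  simp only [prod_update_eq_mul_erase]
  rw [← Finset.sum_mul, (hμ i).2, one_mul, div_eq_iff hR, coordAvg, Finset.sum_mul]
  exact Finset.sum_congr rfl fun a _ => mul_right_comm _ _ _

theorem HphiCond_prod_eq (hμ : ∀ i, IsPMF (μ i)) (Φ : ℝ → ℝ) (i : ι) (g : (∀ i, α i) → ℝ) :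
    HphiCond Φ (fun ω => ∏ j, μ j (ω j)) g (fun ω => fun j : {j : ι // j ≠ i} => ω j.1) =
      expect (fun ω => ∏ j, μ j (ω j)) (fun ω => Φ (g ω)) -
        expect (fun ω => ∏ j, μ j (ω j)) (fun ω => Φ (coordAvg μ i g ω)) := by
  rw [HphiCond]
  congr 1
  refine Finset.sum_congr rfl fun ω _ => ?_
  dsimp only
  by_cases hω : ∏ j, μ j (ω j) = 0
  · rw [hω, zero_mul, zero_mul]
  · rw [condExp_prod_eq_coordAvg hμ i g hω]

end Product

open scoped Classical in
theorem isPMF_marginal {Ω β : Type*} [Fintype Ω] [Fintype β] {p : Ω → ℝ} (hp : IsPMF p)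
    (X : Ω → β) : IsPMF fun b => ∑ ω, if X ω = b then p ω else 0 := by
  refine ⟨fun b => Finset.sum_nonneg fun ω _ => ?_, ?_⟩
  · split_ifs
    exacts [hp.1 ω, le_rfl]
  · rw [Finset.sum_comm]
    simpa using hp.2

open scoped Classical in
/-- Subadditivity of Φ-entropy: if `X_1, …, X_k` are mutually independent
(joint pmf `p` equals the product of its marginals) and `Φ ∈ 𝓕`, then for any `f` with range
in the domain of `Φ` one has `H_Φ(f) ≤ Σ_i H_Φ(f | X_{î})`, where `X_{î}` omits the `i`-th
coordinate. -/
theorem phi_entropy_subadditivity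
    {k : ℕ} {α : Fin k → Type} [∀ i, Fintype (α i)]
    (p : (∀ i, α i) → ℝ) (hp : IsPMF p)
    (hind : ∀ ω, p ω = ∏ i, ∑ ω', if ω' i = ω i then p ω' else 0)
    (F : ClassF) (f : (∀ i, α i) → ℝ) (hf : ∀ ω, f ω ∈ F.D) :
    Hphi F.Φ p f
      ≤ ∑ i, HphiCond F.Φ p f (fun ω => (fun j : {j : Fin k // j ≠ i} => ω j.1)) := by
  let μ : ∀ i, α i → ℝ := fun i a => ∑ ω', if ω' i = a then p ω' else 0
  have hμ : ∀ i, IsPMF (μ i) := fun i => isPMF_marginal hp fun ω => ω i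
  have hpμ : p = fun ω => ∏ j, μ j (ω j) := funext hind
  clear_value μ
  subst hpμ
  simp only [HphiCond_prod_eq hμ]
  exact Hphi_prod_le_sum_coordAvg hμ F hf

end
end

section
/- Let X_1, …, X_k be mutually independent random variables taking values in finite sets and let Φ be a function in the class 𝓕. Then the Φ-ribbon satisfies 𝓡_Φ(X_1, …, X_k) = [0,1]^k; equivalently, for every real-valued function f of (X_1, …, X_k) whose range lies in the domain of Φ, one has H_Φ(f) ≥ Σ_{i=1}^k H_Φ(E[f | X_i]). -/
open Finset

noncomputable section

/-- Finite-sum form of the convexity of the Φ-entropy in the function. -/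
lemma ClassF.convexOn_entropy_finset (F : ClassF) {β : Type*} (s : Finset β) :
    ∀ w : β → ℝ, (∀ b ∈ s, 0 ≤ w b) → ∑ b ∈ s, w b = 1 →
      ConvexOn ℝ {g : β → ℝ | ∀ b, g b ∈ F.D}
        (fun g => ∑ b ∈ s, w b * F.Φ (g b) - F.Φ (∑ b ∈ s, w b * g b)) := by
  classical
  have hconv : Convex ℝ {g : β → ℝ | ∀ b, g b ∈ F.D} := by
    intro g hg h hh a b ha hb hab c
    exact F.convex_dom (hg c) (hh c) ha hb hab
  induction s using Finset.induction_on with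
  | empty => intro w _ h1; simp at h1
  | insert a s has ih =>
    intro w h0 h1
    rw [Finset.sum_insert has] at h1
    have h0s : ∀ b ∈ s, 0 ≤ w b := fun b hb => h0 b (Finset.mem_insert_of_mem hb)
    have h0a : 0 ≤ w a := h0 a (Finset.mem_insert_self a s)
    set c := ∑ b ∈ s, w b with hc
    have hc0 : 0 ≤ c := Finset.sum_nonneg h0s
    rcases hc0.eq_or_lt with hcz | hcpos
    · have hz : ∀ b ∈ s, w b = 0 :=
        (Finset.sum_eq_zero_iff_of_nonneg h0s).1 (hc ▸ hcz.symm)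
      have hwa : w a = 1 := by linarith
      have hsum : ∀ φ : β → ℝ, ∑ b ∈ s, w b * φ b = 0 := fun φ =>
        Finset.sum_eq_zero fun b hb => by rw [hz b hb, zero_mul]
      refine (convexOn_const (0 : ℝ) hconv).congr fun g _ => ?_
      simp only [Finset.sum_insert has, hwa]
      rw [hsum g, hsum fun b => F.Φ (g b)]
      simp
    · have hdiv : ∑ b ∈ s, w b / c = 1 := by
        rw [← Finset.sum_div]; exact div_self hcpos.ne'
      have hdiv0 : ∀ b ∈ s, 0 ≤ w b / c := fun b hb => div_nonneg (h0s b hb) hc0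
      have hrest := ih (fun b => w b / c) hdiv0 hdiv
      let L : (β → ℝ) →ₗ[ℝ] ℝ × ℝ :=
        (∑ b ∈ s, (w b / c) • LinearMap.proj b).prod (LinearMap.proj a)
      have hL : ∀ g, L g = (∑ b ∈ s, w b / c * g b, g a) := fun g => by simp [L]
      have htwo := (F.joint_convex c ⟨hc0, by linarith⟩).comp_linearMap L
      have hsub : {g : β → ℝ | ∀ b, g b ∈ F.D} ⊆ L ⁻¹' (F.D ×ˢ F.D) := by
        intro g hg
        rw [Set.mem_preimage, hL]
        exact ⟨F.convex_dom.sum_mem hdiv0 hdiv fun b _ => hg b, hg a⟩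
      refine ((hrest.smul hc0).add (htwo.subset hsub hconv)).congr fun g _ => ?_
      have hmul : ∀ φ : β → ℝ, c * ∑ b ∈ s, w b / c * φ b = ∑ b ∈ s, w b * φ b := by
        intro φ
        rw [Finset.mul_sum]
        refine Finset.sum_congr rfl fun b _ => ?_
        field_simp
      simp only [Pi.add_apply, Function.comp_apply, hL, smul_eq_mul, mul_sub,
        Finset.sum_insert has]
      rw [hmul, hmul, show 1 - c = w a by linarith, add_comm (∑ b ∈ s, w b * g b)]
      ring

/-- For `Φ ∈ 𝓕`, the Φ-entropy is convex in the function. -/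
lemma ClassF.convexOn_Hphi (F : ClassF) {β : Type*} [Fintype β] {w : β → ℝ} (hw : IsPMF w) :
    ConvexOn ℝ {g : β → ℝ | ∀ b, g b ∈ F.D} (Hphi F.Φ w) :=
  F.convexOn_entropy_finset Finset.univ w (fun b _ => hw.1 b) hw.2

lemma Fin.sum_pi_insertNth {n : ℕ} {α : Fin (n + 1) → Type*} [∀ i, Fintype (α i)]
    (i : Fin (n + 1)) (G : (∀ j, α j) → ℝ) :
    ∑ ω, G ω = ∑ x : α i, ∑ ω' : ∀ j, α (i.succAbove j), G (i.insertNth x ω') := by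
  rw [← Fintype.sum_prod_type', ← (Fin.insertNthEquiv α i).sum_comp]
  rfl

lemma Fin.sum_pi_cons {n : ℕ} {α : Fin (n + 1) → Type*} [∀ i, Fintype (α i)]
    (G : (∀ j, α j) → ℝ) :
    ∑ ω, G ω = ∑ x : α 0, ∑ ω' : ∀ j : Fin n, α j.succ, G (Fin.cons x ω') := by
  rw [← Fintype.sum_prod_type', ← (Fin.consEquiv α).sum_comp]
  rfl

lemma IsPMF.pi {ι : Type*} [Fintype ι] [DecidableEq ι] {α : ι → Type*} [∀ i, Fintype (α i)]
    {m : ∀ i, α i → ℝ} (hm : ∀ i, IsPMF (m i)) :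
    IsPMF (fun ω : ∀ i, α i => ∏ i, m i (ω i)) := by
  refine ⟨fun ω => Finset.prod_nonneg fun i _ => (hm i).1 _, ?_⟩
  rw [← Fintype.prod_sum]
  exact Finset.prod_eq_one fun i _ => (hm i).2

/-- Under a product measure, the Φ-entropy dominates the sum of the Φ-entropies of the
one-coordinate conditional expectations. -/
lemma ClassF.sum_Hphi_marginal_le (F : ClassF) {k : ℕ} :
    ∀ {α : Fin k → Type} [∀ i, Fintype (α i)] (m : ∀ i, α i → ℝ), (∀ i, IsPMF (m i)) →
      ∀ f : (∀ i, α i) → ℝ, (∀ ω, f ω ∈ F.D) →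
        ∑ i, Hphi F.Φ (m i)
            (fun x => ∑ ω : ∀ i, α i, (∏ j, m j (ω j)) * f (Function.update ω i x)) ≤
          Hphi F.Φ (fun ω => ∏ j, m j (ω j)) f := by
  induction k with
  | zero =>
    intro α _ m hm f hf
    simp [Hphi, _root_.expect]
  | succ n ih =>
    intro α _ m hm f hf
    set q : (∀ j : Fin n, α j.succ) → ℝ := fun ω' => ∏ j, m j.succ (ω' j) with hq
    have hqp : IsPMF q := IsPMF.pi fun j => hm j.succ
    have hsplit : ∀ G : (∀ j, α j) → ℝ, ∑ ω, (∏ j, m j (ω j)) * G ω =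
        ∑ x, m 0 x * ∑ ω', q ω' * G (Fin.cons x ω') := by
      intro G
      rw [Fin.sum_pi_cons]
      refine Finset.sum_congr rfl fun x _ => ?_
      rw [Finset.mul_sum]
      refine Finset.sum_congr rfl fun ω' _ => ?_
      simp only [Fin.prod_univ_succ, Fin.cons_zero, Fin.cons_succ, hq, mul_assoc]
    have hswap : ∀ G : α 0 → (∀ j : Fin n, α j.succ) → ℝ,
        ∑ x, m 0 x * ∑ ω', q ω' * G x ω' = ∑ ω', q ω' * ∑ x, m 0 x * G x ω' := by
      intro G
      simp only [Finset.mul_sum]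
      rw [Finset.sum_comm]
      refine Finset.sum_congr rfl fun _ _ => Finset.sum_congr rfl fun _ _ => ?_
      ring
    let g : (∀ j : Fin n, α j.succ) → ℝ := fun ω' => ∑ x, m 0 x * f (Fin.cons x ω')
    have hg : ∀ ω', g ω' ∈ F.D := fun ω' =>
      F.convex_dom.sum_mem (fun x _ => (hm 0).1 x) (hm 0).2 fun x _ => hf _
    have hhead : (fun x => ∑ ω : ∀ i, α i, (∏ j, m j (ω j)) * f (Function.update ω 0 x)) =
        fun x => ∑ ω', q ω' * f (Fin.cons x ω') := by
      funext x
      rw [hsplit]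
      simp only [Fin.update_cons_zero]
      rw [← Finset.sum_mul, (hm 0).2, one_mul]
    have htail : ∀ i : Fin n, (fun x => ∑ ω : ∀ i, α i, (∏ j, m j (ω j)) *
        f (Function.update ω i.succ x)) = fun x => ∑ ω', q ω' * g (Function.update ω' i x) := by
      intro i
      funext x
      rw [hsplit, hswap]
      simp only [g, Fin.cons_update]
    have hjensen : Hphi F.Φ q g ≤ ∑ x, m 0 x * Hphi F.Φ q (fun ω' => f (Fin.cons x ω')) := by
      have h := (F.convexOn_Hphi hqp).map_sum_le (t := Finset.univ) (w := m 0)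
        (p := fun x ω' => f (Fin.cons x ω')) (fun x _ => (hm 0).1 x) (hm 0).2
        (fun x _ ω' => hf _)
      have hgs : ∑ x, m 0 x • (fun ω' => f (Fin.cons x ω')) = g := by
        funext ω'
        simp [g]
      rwa [hgs] at h
    have hchain : Hphi F.Φ (fun ω => ∏ j, m j (ω j)) f =
        ∑ x, m 0 x * Hphi F.Φ q (fun ω' => f (Fin.cons x ω')) +
          Hphi F.Φ (m 0) (fun x => ∑ ω', q ω' * f (Fin.cons x ω')) := by
      simp only [Hphi, _root_.expect, hsplit, mul_sub, Finset.sum_sub_distrib]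
      ring
    rw [Fin.sum_univ_succ, hhead, hchain]
    simp only [htail]
    have := ih (fun j => m j.succ) (fun j => hm j.succ) g hg
    linarith

lemma sum_pi_update {k : ℕ} {α : Fin k → Type} [∀ i, Fintype (α i)] [∀ i, DecidableEq (α i)]
    (m : ∀ i, α i → ℝ) (hm : ∀ i, IsPMF (m i)) (f : (∀ i, α i) → ℝ) (i : Fin k) (x : α i) :
    (∑ ω : ∀ i, α i, if ω i = x then (∏ j, m j (ω j)) * f ω else 0) =
      m i x * ∑ ω : ∀ i, α i, (∏ j, m j (ω j)) * f (Function.update ω i x) := by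
  cases k with
  | zero => exact i.elim0
  | succ n =>
    rw [Fin.sum_pi_insertNth i, Fin.sum_pi_insertNth i]
    simp only [Fin.prod_univ_succAbove _ i, Fin.insertNth_apply_same,
      Fin.insertNth_apply_succAbove, Fin.update_insertNth, mul_assoc]
    simp only [← Finset.mul_sum]
    rw [← Finset.sum_mul, (hm i).2, one_mul, Finset.sum_eq_single x]
    · simp [Finset.mul_sum]
    · intro y _ hy
      simp [hy]
    · simp

lemma expect_comp {Ω β : Type*} [Fintype Ω] [Fintype β] [DecidableEq β] (p : Ω → ℝ)
    (X : Ω → β) (h : β → ℝ) :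
    _root_.expect p (fun ω => h (X ω)) =
      _root_.expect (fun x => ∑ ω, if X ω = x then p ω else 0) h := by
  simp only [_root_.expect, Finset.sum_mul, ite_mul, zero_mul]
  rw [Finset.sum_comm]
  simp

open scoped Classical in
/-- If `X_1, …, X_k` are mutually independent (joint pmf `p` equals the
product of its marginals) and `Φ ∈ 𝓕`, then the Φ-ribbon is all of `[0,1]^k`; equivalently,
for every `f` with range in the domain of `Φ`, `H_Φ(f) ≥ Σ_i H_Φ(E[f | X_i])`. -/
theorem indep_phi_ribbon_full
    {k : ℕ} {α : Fin k → Type} [∀ i, Fintype (α i)]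
    (p : (∀ i, α i) → ℝ) (hp : IsPMF p)
    (hind : ∀ ω, p ω = ∏ i, ∑ ω', if ω' i = ω i then p ω' else 0)
    (F : ClassF) (f : (∀ i, α i) → ℝ) (hf : ∀ ω, f ω ∈ F.D) :
    Hphi F.Φ p f ≥ ∑ i, Hphi F.Φ p (condExp p f (fun ω => ω i)) := by
  set m : ∀ i, α i → ℝ := fun i x => ∑ ω, if ω i = x then p ω else 0 with hm_def
  have hm : ∀ i, IsPMF (m i) := fun i => by
    refine ⟨fun x => Finset.sum_nonneg fun ω _ => ?_, ?_⟩
    · split_ifs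
      exacts [hp.1 ω, le_rfl]
    · simp only [hm_def]
      rw [Finset.sum_comm]
      simpa using hp.2
  have hpm : p = fun ω => ∏ j, m j (ω j) := funext hind
  have hterm : ∀ i, Hphi F.Φ p (condExp p f (fun ω => ω i)) = Hphi F.Φ (m i)
      (fun x => ∑ ω : ∀ i, α i, (∏ j, m j (ω j)) * f (Function.update ω i x)) := by
    intro i
    set φ : α i → ℝ :=
      fun x => ∑ ω : ∀ i, α i, (∏ j, m j (ω j)) * f (Function.update ω i x) with hφ
    have hce : ∀ ω, p ω ≠ 0 → condExp p f (fun ω => ω i) ω = φ (ω i) := by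
      intro ω hω
      have hmi : m i (ω i) ≠ 0 := by
        intro h0
        exact hω (by rw [hind ω]; exact Finset.prod_eq_zero (Finset.mem_univ i) h0)
      have hnum := sum_pi_update m hm f i (ω i)
      simp only [← congrFun hpm] at hnum
      change _ / m i (ω i) = _
      rw [div_eq_iff hmi, mul_comm, hφ]
      simp only [← congrFun hpm]
      exact hnum
    have hexp : ∀ Ψ : ℝ → ℝ,
        _root_.expect p (fun ω => Ψ (condExp p f (fun ω => ω i) ω)) =
          _root_.expect (m i) (fun x => Ψ (φ x)) := by
      intro Ψ
      rw [← expect_comp p (fun ω => ω i) (fun x => Ψ (φ x))]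
      refine Finset.sum_congr rfl fun ω _ => ?_
      by_cases hω : p ω = 0
      · simp [hω]
      · simp only [hce ω hω]
    have hmean := hexp id
    simp only [id] at hmean
    unfold Hphi
    rw [hexp F.Φ]
    exact congrArg _ (congrArg F.Φ hmean)
  simp only [hterm]
  have h := F.sum_Hphi_marginal_le m hm f hf
  rwa [← hpm] at h

end
end

section
/- Let Φ be a function in the class 𝓕 whose domain contains [0, ∞), and let (X_1, …, X_k) be random variables taking values in finite sets with joint distribution p. Then the I_Φ-ribbon 𝓡_{I_Φ}(X_1, …, X_k) equals the set 𝓡'_Φ(X_1, …, X_k) of all tuples (λ_1, …, λ_k) of non-negative reals such that for every function f(x_1, …, x_k) with f ≥ 0 and E[f] = 1, one has Σ_{i=1}^k λ_i H_Φ(E[f | X_i]) ≤ H_Φ(f). -/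
open Finset

noncomputable section

/-- The Φ-mutual information `I_Φ(U; X)` of a joint pmf `r` on `υ × Ω`:
`Σ_{u,x} p(u) p(x) Φ(p(u,x)/(p(u)p(x))) − Φ(1)`. -/
def Iphi {υ Ω : Type} [Fintype υ] [Fintype Ω] (Φ : ℝ → ℝ) (r : υ × Ω → ℝ) : ℝ :=
  ∑ u, ∑ ω, (∑ ω', r (u, ω')) * (∑ u', r (u', ω)) *
      Φ (r (u, ω) / ((∑ ω', r (u, ω')) * (∑ u', r (u', ω)))) - Φ 1

/-- If `r (u, ω) = q u * (p ω * g u ω)` has marginals `q` and `p`, its Φ-mutual information is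
the `q`-average of the Φ-entropies of the densities `g u`. -/
lemma Iphi_eq_sum_mul_Hphi {υ Ω : Type} [Fintype υ] [Fintype Ω] (Φ : ℝ → ℝ)
    {p : Ω → ℝ} {q : υ → ℝ} {g : υ → Ω → ℝ} {r : υ × Ω → ℝ}
    (hr : ∀ u ω, r (u, ω) = q u * (p ω * g u ω)) (hg : ∀ u, expect p (g u) = 1)
    (hp : ∀ ω, ∑ u, r (u, ω) = p ω) (hq : ∑ u, q u = 1) :
    Iphi Φ r = ∑ u, q u * Hphi Φ p (g u) := by
  have hq' : ∀ u, ∑ ω, r (u, ω) = q u := fun u => by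
    simp only [hr, ← Finset.mul_sum]
    rw [show ∑ ω, p ω * g u ω = 1 from hg u, mul_one]
  simp only [Iphi, Hphi, hq', hp, hg, mul_sub, Finset.sum_sub_distrib, ← Finset.sum_mul, hq,
    one_mul]
  congr 1
  refine Finset.sum_congr rfl fun u _ => ?_
  rw [_root_.expect, Finset.mul_sum]
  refine Finset.sum_congr rfl fun ω _ => ?_
  by_cases hu : q u = 0
  · simp [hu]
  by_cases hω : p ω = 0
  · simp [hω]
  have : q u * (p ω * g u ω) / (q u * p ω) = g u ω := by field_simp
  rw [hr, this, mul_assoc]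

open scoped Classical in
/-- The law of `X` under `p`. -/
def pushPMF {Ω β : Type*} [Fintype Ω] (p : Ω → ℝ) (X : Ω → β) (b : β) : ℝ :=
  ∑ ω, if X ω = b then p ω else 0

open scoped Classical in
/-- The conditional expectation `E[f | X = b]`. -/
def condExpVal {Ω β : Type*} [Fintype Ω] (p f : Ω → ℝ) (X : Ω → β) (b : β) : ℝ :=
  (∑ ω, if X ω = b then p ω * f ω else 0) / pushPMF p X b

lemma pushPMF_nonneg {Ω β : Type*} [Fintype Ω] {p : Ω → ℝ} (hp : ∀ ω, 0 ≤ p ω) (X : Ω → β)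
    (b : β) : 0 ≤ pushPMF p X b :=
  Finset.sum_nonneg fun ω _ => by split_ifs <;> simp [hp]

lemma condExpVal_nonneg {Ω β : Type*} [Fintype Ω] {p f : Ω → ℝ} (hp : ∀ ω, 0 ≤ p ω)
    (hf : ∀ ω, 0 ≤ f ω) (X : Ω → β) (b : β) : 0 ≤ condExpVal p f X b :=
  div_nonneg (Finset.sum_nonneg fun ω _ => by split_ifs <;> simp [hp, hf, mul_nonneg])
    (pushPMF_nonneg hp X b)

open scoped Classical in
lemma pushPMF_mul_condExpVal {Ω β : Type*} [Fintype Ω] {p : Ω → ℝ} (hp : ∀ ω, 0 ≤ p ω)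
    (f : Ω → ℝ) (X : Ω → β) (b : β) :
    pushPMF p X b * condExpVal p f X b = ∑ ω, if X ω = b then p ω * f ω else 0 := by
  by_cases h : pushPMF p X b = 0
  · rw [h, zero_mul, eq_comm]
    refine Finset.sum_eq_zero fun ω _ => ?_
    have := (Finset.sum_eq_zero_iff_of_nonneg
      (fun ω _ => by split_ifs <;> simp [hp])).1 h ω (Finset.mem_univ _)
    split_ifs at this ⊢ <;> simp [this]
  · rw [condExpVal, mul_div_cancel₀ _ h]

lemma expect_pushPMF {Ω β : Type*} [Fintype Ω] [Fintype β] (p : Ω → ℝ) (X : Ω → β) (h : β → ℝ) :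
    expect (pushPMF p X) h = expect p (fun ω => h (X ω)) := by
  classical
  simp only [_root_.expect, pushPMF, Finset.sum_mul]
  rw [Finset.sum_comm]
  refine Finset.sum_congr rfl fun ω _ => ?_
  simp [ite_mul]

lemma expect_condExpVal {Ω β : Type*} [Fintype Ω] [Fintype β] {p : Ω → ℝ} (hp : ∀ ω, 0 ≤ p ω)
    (f : Ω → ℝ) (X : Ω → β) : expect (pushPMF p X) (condExpVal p f X) = expect p f := by
  classical
  simp only [_root_.expect, pushPMF_mul_condExpVal hp]
  rw [Finset.sum_comm]
  simp

lemma Hphi_condExp {Ω β : Type*} [Fintype Ω] [Fintype β] (Φ : ℝ → ℝ) (p f : Ω → ℝ) (X : Ω → β) :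
    Hphi Φ p (condExp p f X) = Hphi Φ (pushPMF p X) (condExpVal p f X) := by
  simp only [Hphi, expect_pushPMF]
  rfl

open scoped Classical in
lemma Iphi_marginal_eq_sum_mul_Hphi {υ Ω β : Type} [Fintype υ] [Fintype Ω] [Fintype β]
    (Φ : ℝ → ℝ) {p : Ω → ℝ} {q : υ → ℝ} {g : υ → Ω → ℝ} {r : υ × Ω → ℝ} (hp0 : ∀ ω, 0 ≤ p ω)
    (hr : ∀ u ω, r (u, ω) = q u * (p ω * g u ω)) (hg : ∀ u, expect p (g u) = 1)
    (hp : ∀ ω, ∑ u, r (u, ω) = p ω) (hq : ∑ u, q u = 1) (X : Ω → β) :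
    Iphi Φ (fun ux : υ × β => ∑ ω, if X ω = ux.2 then r (ux.1, ω) else 0)
      = ∑ u, q u * Hphi Φ p (condExp p (g u) X) := by
  simp only [Hphi_condExp]
  refine Iphi_eq_sum_mul_Hphi Φ (fun u b => ?_) (fun u => ?_) (fun b => ?_) hq
  · rw [pushPMF_mul_condExpVal hp0, Finset.mul_sum]
    exact Finset.sum_congr rfl fun ω _ => by simp [hr]
  · rw [expect_condExpVal hp0, hg]
  · rw [Finset.sum_comm]
    refine Finset.sum_congr rfl fun ω _ => ?_
    split_ifs <;> simp [hp]

lemma Hphi_nonneg {Ω : Type*} [Fintype Ω] {Φ : ℝ → ℝ} {D : Set ℝ} (hΦ : ConvexOn ℝ D Φ)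
    {p : Ω → ℝ} (hp : IsPMF p) {f : Ω → ℝ} (hf : ∀ ω, f ω ∈ D) : 0 ≤ Hphi Φ p f := by
  have := hΦ.map_sum_le (t := Finset.univ) (fun ω _ => hp.1 ω) hp.2 (fun ω _ => hf ω)
  simpa [Hphi, _root_.expect] using this

lemma expect_perturbation {Ω : Type*} [Fintype Ω] {p : Ω → ℝ} (hp : IsPMF p) {f : Ω → ℝ}
    (hf : expect p f = 1) (δ : ℝ) : expect p (fun ω => 1 + δ * (1 - f ω)) = 1 := by
  have : ∀ ω, p ω * (1 + δ * (1 - f ω)) = p ω + δ * (p ω - p ω * f ω) := fun ω => by ring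
  simp only [_root_.expect, this, Finset.sum_add_distrib, ← Finset.mul_sum,
    Finset.sum_sub_distrib, hp.2]
  rw [show ∑ ω, p ω * f ω = 1 from hf]
  ring

/-- First-order behaviour of the Φ-entropy around the constant `1`. -/
lemma tendsto_Hphi_perturbation {Ω : Type*} [Fintype Ω] {Φ : ℝ → ℝ}
    (hΦ : DifferentiableAt ℝ Φ 1) {p : Ω → ℝ} (hp : IsPMF p) {f : Ω → ℝ} (hf : expect p f = 1) :
    Filter.Tendsto (fun δ : ℝ => Hphi Φ p (fun ω => 1 + δ * (1 - f ω)) / δ)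
      (nhdsWithin 0 (Set.Ioi 0)) (nhds 0) := by
  have hd : HasDerivAt (fun δ : ℝ => Hphi Φ p (fun ω => 1 + δ * (1 - f ω))) 0 0 := by
    simp only [Hphi, expect_perturbation hp hf]
    have h1 : ∀ ω ∈ (Finset.univ : Finset Ω),
        HasDerivAt (fun δ : ℝ => p ω * Φ (1 + δ * (1 - f ω)))
          (p ω * (deriv Φ 1 * (1 - f ω))) 0 := fun ω _ => by
      refine HasDerivAt.const_mul _ ?_
      have hin : HasDerivAt (fun δ : ℝ => 1 + δ * (1 - f ω)) (1 - f ω) 0 := by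
        simpa using ((hasDerivAt_id (0 : ℝ)).mul_const (1 - f ω)).const_add 1
      refine HasDerivAt.comp (0 : ℝ) (h₂ := Φ) ?_ hin
      simpa using hΦ.hasDerivAt
    have h2 := (HasDerivAt.fun_sum h1).sub_const (Φ 1)
    have h3 : ∑ ω, p ω * (deriv Φ 1 * (1 - f ω)) = 0 := by
      have : ∀ ω, p ω * (deriv Φ 1 * (1 - f ω)) = deriv Φ 1 * (p ω - p ω * f ω) :=
        fun ω => by ring
      simp only [this, ← Finset.mul_sum, Finset.sum_sub_distrib, hp.2]
      rw [show ∑ ω, p ω * f ω = 1 from hf]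
      ring
    rwa [h3] at h2
  have h0 : Hphi Φ p (fun _ => 1) = 0 := by
    simp [Hphi, _root_.expect, ← Finset.sum_mul, hp.2]
  have := (hasDerivAt_iff_tendsto_slope_zero.1 hd).mono_left
    (nhdsWithin_mono 0 (s := Set.Ioi 0) fun x hx => ne_of_gt (Set.mem_Ioi.1 hx))
  simpa [h0, div_eq_inv_mul] using this

lemma ClassF.differentiableAt_one (F : ClassF) (hD : Set.Ici (0:ℝ) ⊆ F.D) :
    DifferentiableAt ℝ F.Φ 1 :=
  (F.smooth.contDiffAt (Filter.mem_of_superset (Ici_mem_nhds one_pos) hD)).differentiableAt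
    (by simp)

/-- The density `p(u, ω) / (p(u) p(ω))`, with value `1` when `p(u) = 0`. -/
lemma exists_density {υ Ω : Type*} [Fintype υ] [Fintype Ω] {p : Ω → ℝ} (hp : IsPMF p)
    {r : υ × Ω → ℝ} (hr : IsPMF r) (hrp : ∀ ω, ∑ u, r (u, ω) = p ω) :
    ∃ g : υ → Ω → ℝ, (∀ u ω, 0 ≤ g u ω) ∧ (∀ u, expect p (g u) = 1) ∧
      ∀ u ω, r (u, ω) = (∑ ω', r (u, ω')) * (p ω * g u ω) := by
  classical
  have hq0 : ∀ u, 0 ≤ ∑ ω, r (u, ω) := fun u => Finset.sum_nonneg fun ω _ => hr.1 _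
  have hru : ∀ u, ∑ ω, r (u, ω) = 0 → ∀ ω, r (u, ω) = 0 := fun u h ω =>
    (Finset.sum_eq_zero_iff_of_nonneg (fun ω _ => hr.1 (u, ω))).1 h ω (Finset.mem_univ _)
  have hrω : ∀ ω, p ω = 0 → ∀ u, r (u, ω) = 0 := fun ω h u =>
    (Finset.sum_eq_zero_iff_of_nonneg (fun u _ => hr.1 (u, ω))).1 ((hrp ω).trans h) u
      (Finset.mem_univ _)
  refine ⟨fun u ω => if ∑ ω', r (u, ω') = 0 then 1 else r (u, ω) / ((∑ ω', r (u, ω')) * p ω),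
    fun u ω => ?_, fun u => ?_, fun u ω => ?_⟩
  · dsimp only
    split_ifs
    · exact zero_le_one
    · exact div_nonneg (hr.1 _) (mul_nonneg (hq0 u) (hp.1 ω))
  · by_cases hu : ∑ ω, r (u, ω) = 0
    · simp [_root_.expect, hu, hp.2]
    · have : ∀ ω, p ω * (r (u, ω) / ((∑ ω', r (u, ω')) * p ω)) = r (u, ω) / ∑ ω', r (u, ω') :=
        fun ω => by
          by_cases hω : p ω = 0
          · simp [hω, hrω ω hω u]
          · field_simp
      simp only [_root_.expect, if_neg hu, this, ← Finset.sum_div]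
      exact div_self hu
  · by_cases hu : ∑ ω, r (u, ω) = 0
    · simp [hru u hu]
    by_cases hω : p ω = 0
    · simp [hω, hrω ω hω u]
    simp only [if_neg hu]
    field_simp

open scoped Classical in
/-- For `Φ ∈ 𝓕` with `[0,∞)` contained in its domain, the `I_Φ`-ribbon of
`(X_1, …, X_k)` (tuples `λ ≥ 0` such that `Σ_i λ_i I_Φ(U;X_i) ≤ I_Φ(U;X_{[k]})` for every
finite-valued `U` jointly distributed with `X_{[k]}`) equals the set `𝓡'_Φ` of all `λ ≥ 0`
such that `Σ_i λ_i H_Φ(E[f|X_i]) ≤ H_Φ(f)` for every `f ≥ 0` with `E[f] = 1`. -/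
theorem Iphi_ribbon_eq_ribbon'
    {k : ℕ} {α : Fin k → Type} [∀ i, Fintype (α i)]
    (p : (∀ i, α i) → ℝ) (hp : IsPMF p)
    (F : ClassF) (hD : Set.Ici (0:ℝ) ⊆ F.D) :
    {l : Fin k → ℝ | (∀ i, 0 ≤ l i) ∧
        ∀ (υ : Type) [Fintype υ], ∀ r : υ × (∀ i, α i) → ℝ,
          IsPMF r → (∀ ω, ∑ u, r (u, ω) = p ω) →
          ∑ i, l i * Iphi F.Φ (fun ux : υ × α i => ∑ ω, if ω i = ux.2 then r (ux.1, ω) else 0)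
            ≤ Iphi F.Φ r}
      = {l : Fin k → ℝ | (∀ i, 0 ≤ l i) ∧
          ∀ f : (∀ i, α i) → ℝ, (∀ ω, 0 ≤ f ω) → expect p f = 1 →
            ∑ i, l i * Hphi F.Φ p (condExp p f (fun ω => ω i)) ≤ Hphi F.Φ p f} := by
  refine Set.ext fun l => and_congr_right fun hl => ⟨fun H f hf hE => ?_, fun H υ _ r hr hrp => ?_⟩
  · have hlim := (tendsto_Hphi_perturbation (F.differentiableAt_one hD) hp hE).const_add
      (Hphi F.Φ p f)
    rw [add_zero] at hlim
    have hpos : ∀ᶠ δ : ℝ in nhdsWithin 0 (Set.Ioi 0), ∀ ω, 0 < 1 + δ * (1 - f ω) := by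
      refine nhdsWithin_le_nhds (Filter.eventually_all.2 fun ω => ?_)
      have hc : Continuous fun δ : ℝ => 1 + δ * (1 - f ω) := by fun_prop
      exact hc.continuousAt.eventually (lt_mem_nhds (by simp))
    refine ge_of_tendsto hlim ?_
    filter_upwards [hpos, self_mem_nhdsWithin] with δ hδ hδ0
    replace hδ0 : 0 < δ := hδ0
    have hδ1 : (1 : ℝ) + δ ≠ 0 := by positivity
    set g' : (∀ i, α i) → ℝ := fun ω => 1 + δ * (1 - f ω)
    let g : Bool → (∀ i, α i) → ℝ := fun b => bif b then f else g'
    let q : Bool → ℝ := fun b => bif b then δ / (1 + δ) else 1 / (1 + δ)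
    let r : Bool × (∀ i, α i) → ℝ := fun x => q x.1 * (p x.2 * g x.1 x.2)
    have hr : ∀ u ω, r (u, ω) = q u * (p ω * g u ω) := fun _ _ => rfl
    have hq : ∑ u, q u = 1 := by
      simp only [Fintype.sum_bool, q, cond_true, cond_false]
      field_simp
      ring
    have hrp : ∀ ω, ∑ u, r (u, ω) = p ω := fun ω => by
      simp only [Fintype.sum_bool, r, q, g, g', cond_true, cond_false]
      field_simp
      ring
    have hg : ∀ u, expect p (g u) = 1 := by
      rintro (_ | _)
      exacts [expect_perturbation hp hE δ, hE]
    have hrpmf : IsPMF r := by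
      refine ⟨?_, ?_⟩
      · rintro ⟨_ | _, ω⟩
        · exact mul_nonneg (div_nonneg zero_le_one (by positivity))
            (mul_nonneg (hp.1 ω) (hδ ω).le)
        · exact mul_nonneg (div_nonneg hδ0.le (by positivity)) (mul_nonneg (hp.1 ω) (hf ω))
      · rw [Fintype.sum_prod_type_right]
        simp only [hrp, hp.2]
    have key := H Bool r hrpmf hrp
    rw [Iphi_eq_sum_mul_Hphi F.Φ hr hg hrp hq] at key
    simp only [Iphi_marginal_eq_sum_mul_Hphi F.Φ hp.1 hr hg hrp hq] at key
    simp only [Fintype.sum_bool, q, g, cond_true, cond_false] at key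
    have hJ : ∀ i, 0 ≤ Hphi F.Φ p (condExp p g' fun ω => ω i) := fun i =>
      Hphi_nonneg F.convexOn hp fun ω => hD (condExpVal_nonneg hp.1 (fun ω => (hδ ω).le) _ _)
    have hle : ∑ i, l i * (δ / (1 + δ) * Hphi F.Φ p (condExp p f fun ω => ω i)) ≤
        δ / (1 + δ) * Hphi F.Φ p f + 1 / (1 + δ) * Hphi F.Φ p g' :=
      (Finset.sum_le_sum fun i _ => mul_le_mul_of_nonneg_left
        (le_add_of_nonneg_right (mul_nonneg (by positivity) (hJ i))) (hl i)).trans key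
    simp only [mul_left_comm (l _) (δ / (1 + δ))] at hle
    rw [← Finset.mul_sum] at hle
    refine le_of_mul_le_mul_left (hle.trans_eq ?_) (show 0 < δ / (1 + δ) by positivity)
    field_simp
  · obtain ⟨g, hg0, hg, hrg⟩ := exists_density hp hr hrp
    have hq : ∑ u, ∑ ω, r (u, ω) = 1 := by rw [← Fintype.sum_prod_type, hr.2]
    rw [Iphi_eq_sum_mul_Hphi F.Φ hrg hg hrp hq]
    simp only [Iphi_marginal_eq_sum_mul_Hphi F.Φ hp.1 hrg hg hrp hq, Finset.mul_sum]
    rw [Finset.sum_comm]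
    refine Finset.sum_le_sum fun u _ => ?_
    simp only [mul_left_comm (l _)]
    rw [← Finset.mul_sum]
    exact mul_le_mul_of_nonneg_left (H (g u) (hg0 u) (hg u))
      (Finset.sum_nonneg fun ω _ => hr.1 _)


end
end
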